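/- arXiv:2602.08637 — 3 statements merged into one kernel-verified Lean document; each statement's English description precedes it below -/
import Mathlib

section
/- Let V_1 and V_2 be finite-dimensional complex vector spaces, each equipped with a nondegenerate symmetric bilinear form, and equip V = V_1 ⊕ V_2 with the orthogonal direct-sum form. Assume dim V_1 = 2m is even. If W ⊆ V is an isotropic subspace with dim(W ∩ V_1) = m, then W = (W ∩ V_1) ⊕ (W ∩ V_2). -/
/-- An isotropic subspace of half the dimension of a nondegenerate bilinear space is its own
orthogonal complement. -/
lemma LinearMap.BilinForm.orthogonal_eq_self_of_finrank {K V : Type*} [Field K] [AddCommGroup V]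
    [Module K V] [FiniteDimensional K V] {B : LinearMap.BilinForm K V} (hB : B.Nondegenerate)
    {L : Submodule K V} (hL : L ≤ B.orthogonal L)
    (hdim : Module.finrank K V = 2 * Module.finrank K L) : B.orthogonal L = L := by
  refine (Submodule.eq_of_le_of_finrank_le hL ?_).symm
  rw [LinearMap.BilinForm.finrank_orthogonal hB]
  lia

/-- If `V₁, V₂` carry nondegenerate symmetric bilinear forms,
`dim V₁ = 2m`, and `W ⊆ V₁ ⊕ V₂` is isotropic for the orthogonal direct-sum form
with `dim (W ∩ V₁) = m`, then `W = (W ∩ V₁) ⊕ (W ∩ V₂)`. -/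
theorem isotropic_splits (V₁ V₂ : Type*)
    [AddCommGroup V₁] [Module ℂ V₁] [FiniteDimensional ℂ V₁]
    [AddCommGroup V₂] [Module ℂ V₂] [FiniteDimensional ℂ V₂]
    (B₁ : V₁ →ₗ[ℂ] V₁ →ₗ[ℂ] ℂ) (B₂ : V₂ →ₗ[ℂ] V₂ →ₗ[ℂ] ℂ)
    (hB₁symm : ∀ x y, B₁ x y = B₁ y x) (hB₂symm : ∀ x y, B₂ x y = B₂ y x)
    (hB₁nd : ∀ x, (∀ y, B₁ x y = 0) → x = 0)
    (hB₂nd : ∀ x, (∀ y, B₂ x y = 0) → x = 0)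
    (m : ℕ) (hm : Module.finrank ℂ V₁ = 2 * m)
    (W : Submodule ℂ (V₁ × V₂))
    (hiso : ∀ x ∈ W, ∀ y ∈ W, B₁ x.1 y.1 + B₂ x.2 y.2 = 0)
    (hdim : Module.finrank ℂ ↥(W ⊓ Submodule.fst ℂ V₁ V₂) = m) :
    W = (W ⊓ Submodule.fst ℂ V₁ V₂) ⊔ (W ⊓ Submodule.snd ℂ V₁ V₂) := by
  let B : LinearMap.BilinForm ℂ V₁ := B₁
  have hB : B.Nondegenerate :=
    ⟨hB₁nd, fun x hx => hB₁nd x fun y => (hB₁symm x y).trans (hx y)⟩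
  let L : Submodule ℂ V₁ := W.comap (LinearMap.inl ℂ V₁ V₂)
  have hLmap : W ⊓ Submodule.fst ℂ V₁ V₂ = L.map (LinearMap.inl ℂ V₁ V₂) := by
    ext ⟨x, y⟩
    constructor
    · rintro ⟨hW, hy⟩
      obtain rfl : y = 0 := hy
      exact ⟨x, hW, rfl⟩
    · rintro ⟨x', hx', h⟩
      rw [← h]
      exact ⟨hx', rfl⟩
  have hLdim : Module.finrank ℂ V₁ = 2 * Module.finrank ℂ L := by
    rw [hm, ← hdim, hLmap,
      (Submodule.equivMapOfInjective (LinearMap.inl ℂ V₁ V₂) LinearMap.inl_injective L).finrank_eq]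
  have hWL : ∀ w ∈ W, w.1 ∈ B.orthogonal L := fun w hw x hx => by
    simpa using hiso (x, 0) hx w hw
  have hLperp : B.orthogonal L = L :=
    LinearMap.BilinForm.orthogonal_eq_self_of_finrank hB (fun x hx => hWL (x, 0) hx) hLdim
  refine le_antisymm (fun w hw => ?_) (sup_le inf_le_left inf_le_left)
  have h₁ : (w.1, (0 : V₂)) ∈ W := hLperp.le (hWL w hw)
  have h₂ : ((0 : V₁), w.2) ∈ W := by
    simpa [Prod.sub_def] using W.sub_mem hw h₁
  exact Submodule.mem_sup.2 ⟨_, ⟨h₁, rfl⟩, _, ⟨h₂, rfl⟩, by simp⟩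
end

section
/- Let V_1 and V_2 be finite-dimensional complex vector spaces with nondegenerate symmetric bilinear forms, dim V_1 = n_1 odd and dim V_2 = n_2, and equip V = V_1 ⊕ V_2 with the orthogonal direct-sum form. Let 𝐖 be the set of isotropic subspaces W ⊆ V with dim W = ⌊(n_1+n_2)/2⌋ and dim(W ∩ V_1) = (n_1−1)/2, and let 𝐖_1 be the set of isotropic subspaces of V_1 of dimension (n_1−1)/2. Then: (i) the map φ(W) = W ∩ V_1 sends 𝐖 into 𝐖_1; (ii) for every W_1 ∈ 𝐖_1, every W in the fiber φ^{−1}(W_1) satisfies W ⊆ W_1^⊥ ⊕ V_2 (where W_1^⊥ is the orthogonal complement of W_1 in V_1), and the map sending W to its image under the quotient map W_1^⊥ ⊕ V_2 → (W_1^⊥/W_1) ⊕ V_2 is a bijection from φ^{−1}(W_1) onto the set of isotropic subspaces of dimension ⌊(n_1+n_2)/2⌋ − (n_1−1)/2 of the (n_2+1)-dimensional space (W_1^⊥/W_1) ⊕ V_2, equipped with the nondegenerate symmetric form which is the orthogonal direct sum of the form induced on W_1^⊥/W_1 by the form of V_1 and the form of V_2. -/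
/-- The orthogonal complement of `U` with respect to the bilinear form `B`. -/
def orthComp {V : Type*} [AddCommGroup V] [Module ℂ V]
    (B : V →ₗ[ℂ] V →ₗ[ℂ] ℂ) (U : Submodule ℂ V) : Submodule ℂ V where
  carrier := {v | ∀ u ∈ U, B v u = 0}
  add_mem' := by
    intro a b ha hb u hu
    simp only [Set.mem_setOf_eq] at *
    simp [map_add, ha u hu, hb u hu]
  zero_mem' := by
    intro u _
    simp
  smul_mem' := by
    intro c a ha u hu
    simp only [Set.mem_setOf_eq] at *
    simp [ha u hu]

/-- `W₁` viewed as a submodule of its orthogonal complement `W₁^⊥` (for isotropic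
`W₁` one has `W₁ ⊆ W₁^⊥`). -/
def innerCopy {V : Type*} [AddCommGroup V] [Module ℂ V]
    (B : V →ₗ[ℂ] V →ₗ[ℂ] ℂ) (W₁ : Submodule ℂ V) :
    Submodule ℂ ↥(orthComp B W₁) :=
  W₁.comap (orthComp B W₁).subtype

/-- The quotient space `W₁^⊥ / W₁`. -/
abbrev OrthQuot {V : Type*} [AddCommGroup V] [Module ℂ V]
    (B : V →ₗ[ℂ] V →ₗ[ℂ] ℂ) (W₁ : Submodule ℂ V) : Type _ :=
  ↥(orthComp B W₁) ⧸ innerCopy B W₁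

/-- The image of a subspace `W ⊆ W₁^⊥ ⊕ V₂` under the quotient map
`W₁^⊥ ⊕ V₂ → (W₁^⊥/W₁) ⊕ V₂`. -/
def quotImage {V₁ V₂ : Type*} [AddCommGroup V₁] [Module ℂ V₁]
    [AddCommGroup V₂] [Module ℂ V₂]
    (B₁ : V₁ →ₗ[ℂ] V₁ →ₗ[ℂ] ℂ) (W₁ : Submodule ℂ V₁)
    (W : Submodule ℂ (V₁ × V₂)) :
    Submodule ℂ (OrthQuot B₁ W₁ × V₂) :=
  Submodule.map
    (LinearMap.prodMap (innerCopy B₁ W₁).mkQ (LinearMap.id : V₂ →ₗ[ℂ] V₂))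
    (W.comap
      (LinearMap.prodMap (orthComp B₁ W₁).subtype (LinearMap.id : V₂ →ₗ[ℂ] V₂)))

open Module

lemma Submodule.finrank_comap_of_surjective {K V V' : Type*} [DivisionRing K]
    [AddCommGroup V] [Module K V] [AddCommGroup V'] [Module K V'] [FiniteDimensional K V]
    (f : V →ₗ[K] V') (hf : Function.Surjective f) (U : Submodule K V') :
    finrank K ↥(U.comap f) = finrank K ↥U + finrank K ↥(LinearMap.ker f) := by
  have h := LinearMap.finrank_range_add_finrank_ker (f.domRestrict (U.comap f))
  have hker : LinearMap.ker f ≤ U.comap f := fun x hx => by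
    simp [LinearMap.mem_ker.1 hx]
  rw [LinearMap.range_domRestrict, Submodule.map_comap_eq_of_surjective hf,
    LinearMap.ker_domRestrict] at h
  rw [← h]
  exact congrArg _ (Submodule.comapSubtypeEquivOfLe hker).finrank_eq

section Slice

variable {K V₁ V₂ : Type*} [DivisionRing K] [AddCommGroup V₁] [Module K V₁]
  [AddCommGroup V₂] [Module K V₂]

lemma Submodule.map_fst_inf_fst (W : Submodule K (V₁ × V₂)) :
    (W ⊓ Submodule.fst K V₁ V₂).map (LinearMap.fst K V₁ V₂) =
      W.comap (LinearMap.inl K V₁ V₂) := by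
  ext x
  simp [Submodule.fst]

lemma Submodule.finrank_inf_fst (W : Submodule K (V₁ × V₂)) :
    finrank K ↥(W ⊓ Submodule.fst K V₁ V₂) =
      finrank K ↥(W.comap (LinearMap.inl K V₁ V₂)) := by
  have h : W ⊓ Submodule.fst K V₁ V₂ =
      (W.comap (LinearMap.inl K V₁ V₂)).map (LinearMap.inl K V₁ V₂) := by
    ext ⟨x, y⟩
    simp only [Submodule.mem_inf, Submodule.fst, Submodule.mem_comap, Submodule.mem_map,
      LinearMap.snd_apply, LinearMap.inl_apply, Submodule.mem_bot, Prod.mk.injEq]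
    constructor
    · rintro ⟨hx, rfl⟩
      exact ⟨x, hx, rfl, rfl⟩
    · rintro ⟨z, hz, rfl, rfl⟩
      exact ⟨hz, rfl⟩
  rw [h]
  exact (Submodule.equivMapOfInjective _ LinearMap.inl_injective _).finrank_eq.symm

end Slice

section OrthComp

variable {V : Type*} [AddCommGroup V] [Module ℂ V] {B : V →ₗ[ℂ] V →ₗ[ℂ] ℂ}

lemma le_orthComp_of_isotropic {U : Submodule ℂ V} (hU : ∀ x ∈ U, ∀ y ∈ U, B x y = 0) :
    U ≤ orthComp B U :=
  hU

lemma finrank_add_finrank_orthComp [FiniteDimensional ℂ V] (hsymm : ∀ x y, B x y = B y x)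
    (hnd : ∀ x, (∀ y, B x y = 0) → x = 0) (U : Submodule ℂ V) :
    finrank ℂ ↥U + finrank ℂ ↥(orthComp B U) = finrank ℂ V := by
  have horth : orthComp B U = LinearMap.BilinForm.orthogonal B U := by
    ext v
    exact forall₂_congr fun u _ => by rw [hsymm v u]
  have hker : LinearMap.ker B = ⊥ := by
    refine (Submodule.eq_bot_iff _).2 fun x hx => hnd x fun y => ?_
    rw [LinearMap.mem_ker.1 hx, LinearMap.zero_apply]
  have h := LinearMap.BilinForm.finrank_add_finrank_orthogonal' (B := B) U
  rwa [hker, inf_bot_eq, finrank_bot, add_zero, ← horth] at h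

lemma two_mul_finrank_le_of_isotropic [FiniteDimensional ℂ V] (hsymm : ∀ x y, B x y = B y x)
    (hnd : ∀ x, (∀ y, B x y = 0) → x = 0) {U : Submodule ℂ V}
    (hU : ∀ x ∈ U, ∀ y ∈ U, B x y = 0) : 2 * finrank ℂ ↥U ≤ finrank ℂ V := by
  have h₁ := finrank_add_finrank_orthComp hsymm hnd U
  have h₂ := Submodule.finrank_mono (le_orthComp_of_isotropic hU)
  lia

lemma finrank_innerCopy {U : Submodule ℂ V} (hU : ∀ x ∈ U, ∀ y ∈ U, B x y = 0) :
    finrank ℂ ↥(innerCopy B U) = finrank ℂ ↥U :=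
  (Submodule.comapSubtypeEquivOfLe (le_orthComp_of_isotropic hU)).finrank_eq

end OrthComp

section QuotLift

variable {V₁ V₂ : Type*} [AddCommGroup V₁] [Module ℂ V₁] [AddCommGroup V₂] [Module ℂ V₂]
  {B₁ : V₁ →ₗ[ℂ] V₁ →ₗ[ℂ] ℂ} {B₂ : V₂ →ₗ[ℂ] V₂ →ₗ[ℂ] ℂ} {W₁ : Submodule ℂ V₁}

/-- The preimage in `W₁^⊥ ⊕ V₂`, viewed inside `V₁ ⊕ V₂`, of a subspace of
`(W₁^⊥/W₁) ⊕ V₂`. -/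
def quotLift (B₁ : V₁ →ₗ[ℂ] V₁ →ₗ[ℂ] ℂ) (W₁ : Submodule ℂ V₁)
    (U : Submodule ℂ (OrthQuot B₁ W₁ × V₂)) : Submodule ℂ (V₁ × V₂) :=
  Submodule.map
    (LinearMap.prodMap (orthComp B₁ W₁).subtype (LinearMap.id : V₂ →ₗ[ℂ] V₂))
    (U.comap
      (LinearMap.prodMap (innerCopy B₁ W₁).mkQ (LinearMap.id : V₂ →ₗ[ℂ] V₂)))

lemma prodMap_subtype_id_injective :
    Function.Injective
      (LinearMap.prodMap (orthComp B₁ W₁).subtype (LinearMap.id : V₂ →ₗ[ℂ] V₂)) :=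
  Function.Injective.prodMap (Submodule.subtype_injective _) Function.injective_id

lemma prodMap_mkQ_id_surjective :
    Function.Surjective
      (LinearMap.prodMap (innerCopy B₁ W₁).mkQ (LinearMap.id : V₂ →ₗ[ℂ] V₂)) :=
  Function.Surjective.prodMap (Submodule.mkQ_surjective _) Function.surjective_id

lemma ker_prodMap_mkQ_id :
    LinearMap.ker (LinearMap.prodMap (innerCopy B₁ W₁).mkQ (LinearMap.id : V₂ →ₗ[ℂ] V₂)) =
      (innerCopy B₁ W₁).map (LinearMap.inl ℂ _ V₂) := by
  rw [LinearMap.ker_prodMap, Submodule.ker_mkQ, LinearMap.ker_id, Submodule.map_inl]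

lemma quotImage_quotLift (U : Submodule ℂ (OrthQuot B₁ W₁ × V₂)) :
    quotImage B₁ W₁ (quotLift B₁ W₁ U) = U := by
  rw [quotImage, quotLift, Submodule.comap_map_eq_of_injective prodMap_subtype_id_injective,
    Submodule.map_comap_eq_of_surjective prodMap_mkQ_id_surjective]

lemma quotLift_quotImage {W : Submodule ℂ (V₁ × V₂)}
    (hW : W ≤ (orthComp B₁ W₁).prod (⊤ : Submodule ℂ V₂))
    (hW₁ : W₁ ≤ W.comap (LinearMap.inl ℂ V₁ V₂)) :
    quotLift B₁ W₁ (quotImage B₁ W₁ W) = W := by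
  have hker : LinearMap.ker
      (LinearMap.prodMap (innerCopy B₁ W₁).mkQ (LinearMap.id : V₂ →ₗ[ℂ] V₂)) ≤
      W.comap (LinearMap.prodMap (orthComp B₁ W₁).subtype (LinearMap.id : V₂ →ₗ[ℂ] V₂)) := by
    rw [ker_prodMap_mkQ_id, Submodule.map_le_iff_le_comap]
    exact fun x hx => hW₁ hx
  have hrange : LinearMap.range
      (LinearMap.prodMap (orthComp B₁ W₁).subtype (LinearMap.id : V₂ →ₗ[ℂ] V₂)) =
      (orthComp B₁ W₁).prod ⊤ := by
    rw [LinearMap.range_prodMap, Submodule.range_subtype, LinearMap.range_id]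
  rw [quotImage, quotLift, Submodule.comap_map_eq, sup_eq_left.2 hker,
    Submodule.map_comap_eq, hrange, inf_eq_right.2 hW]

lemma finrank_quotLift [FiniteDimensional ℂ V₁] [FiniteDimensional ℂ V₂]
    (hW₁ : ∀ x ∈ W₁, ∀ y ∈ W₁, B₁ x y = 0) (U : Submodule ℂ (OrthQuot B₁ W₁ × V₂)) :
    finrank ℂ ↥(quotLift B₁ W₁ U) = finrank ℂ ↥U + finrank ℂ ↥W₁ := by
  have hcomap := Submodule.finrank_comap_of_surjective
    (LinearMap.prodMap (innerCopy B₁ W₁).mkQ (LinearMap.id : V₂ →ₗ[ℂ] V₂))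
    prodMap_mkQ_id_surjective U
  have hker := (Submodule.equivMapOfInjective (LinearMap.inl ℂ ↥(orthComp B₁ W₁) V₂)
    LinearMap.inl_injective (innerCopy B₁ W₁)).finrank_eq
  rw [← ker_prodMap_mkQ_id, finrank_innerCopy hW₁] at hker
  rw [← hker] at hcomap
  exact (Submodule.equivMapOfInjective _ prodMap_subtype_id_injective _).finrank_eq.symm.trans
    hcomap

lemma le_comap_inl_quotLift (hW₁ : ∀ x ∈ W₁, ∀ y ∈ W₁, B₁ x y = 0)
    (U : Submodule ℂ (OrthQuot B₁ W₁ × V₂)) :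
    W₁ ≤ (quotLift B₁ W₁ U).comap (LinearMap.inl ℂ V₁ V₂) := by
  intro x hx
  have hq : (innerCopy B₁ W₁).mkQ ⟨x, hW₁ x hx⟩ = 0 := by
    rw [← LinearMap.mem_ker, Submodule.ker_mkQ]
    exact hx
  refine ⟨(⟨x, hW₁ x hx⟩, 0), ?_, rfl⟩
  change ((innerCopy B₁ W₁).mkQ ⟨x, hW₁ x hx⟩, (0 : V₂)) ∈ U
  rw [hq]
  exact U.zero_mem

lemma le_orthComp_prod_top {W : Submodule ℂ (V₁ × V₂)}
    (hW : ∀ x ∈ W, ∀ y ∈ W, B₁ x.1 y.1 + B₂ x.2 y.2 = 0) :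
    W ≤ (orthComp B₁ (W.comap (LinearMap.inl ℂ V₁ V₂))).prod (⊤ : Submodule ℂ V₂) :=
  fun x hx => ⟨fun u hu => by simpa using hW x hx _ hu, trivial⟩

lemma isotropic_comap_inl {W : Submodule ℂ (V₁ × V₂)}
    (hW : ∀ x ∈ W, ∀ y ∈ W, B₁ x.1 y.1 + B₂ x.2 y.2 = 0) :
    ∀ x ∈ W.comap (LinearMap.inl ℂ V₁ V₂), ∀ y ∈ W.comap (LinearMap.inl ℂ V₁ V₂),
      B₁ x y = 0 :=
  fun _ hx => (le_orthComp_prod_top hW hx).1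

variable {Bq : OrthQuot B₁ W₁ →ₗ[ℂ] OrthQuot B₁ W₁ →ₗ[ℂ] ℂ}

lemma isotropic_quotImage
    (hBq : ∀ x y : ↥(orthComp B₁ W₁),
      Bq ((innerCopy B₁ W₁).mkQ x) ((innerCopy B₁ W₁).mkQ y) = B₁ x y)
    {W : Submodule ℂ (V₁ × V₂)} (hW : ∀ x ∈ W, ∀ y ∈ W, B₁ x.1 y.1 + B₂ x.2 y.2 = 0) :
    ∀ x ∈ quotImage B₁ W₁ W, ∀ y ∈ quotImage B₁ W₁ W, Bq x.1 y.1 + B₂ x.2 y.2 = 0 := by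
  rintro _ ⟨x, hx, rfl⟩ _ ⟨y, hy, rfl⟩
  exact (congrArg (· + _) (hBq x.1 y.1)).trans (hW _ hx _ hy)

lemma isotropic_quotLift
    (hBq : ∀ x y : ↥(orthComp B₁ W₁),
      Bq ((innerCopy B₁ W₁).mkQ x) ((innerCopy B₁ W₁).mkQ y) = B₁ x y)
    {U : Submodule ℂ (OrthQuot B₁ W₁ × V₂)}
    (hU : ∀ x ∈ U, ∀ y ∈ U, Bq x.1 y.1 + B₂ x.2 y.2 = 0) :
    ∀ x ∈ quotLift B₁ W₁ U, ∀ y ∈ quotLift B₁ W₁ U, B₁ x.1 y.1 + B₂ x.2 y.2 = 0 := by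
  rintro _ ⟨x, hx, rfl⟩ _ ⟨y, hy, rfl⟩
  exact (congrArg (· + _) (hBq x.1 y.1).symm).trans (hU _ hx _ hy)

end QuotLift

/-- Let `V₁, V₂` carry nondegenerate symmetric bilinear forms, with
`n₁ = dim V₁` odd and `n₂ = dim V₂`, and let `𝐖` be the set of isotropic subspaces
`W ⊆ V₁ ⊕ V₂` with `dim W = ⌊(n₁+n₂)/2⌋` and `dim (W ∩ V₁) = (n₁-1)/2`. Then
(i) `W ↦ W ∩ V₁` maps `𝐖` to isotropic subspaces of `V₁` of dimension `(n₁-1)/2`;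
(ii) for each isotropic `W₁ ⊆ V₁ ` of dimension `(n₁-1)/2`, every `W` in the fiber
over `W₁` satisfies `W ⊆ W₁^⊥ ⊕ V₂`, and taking images under the quotient map
`W₁^⊥ ⊕ V₂ → (W₁^⊥/W₁) ⊕ V₂` (a space of dimension `n₂ + 1`, carrying the induced
form) is a bijection from the fiber onto the set of isotropic subspaces of
`(W₁^⊥/W₁) ⊕ V₂` of dimension `⌊(n₁+n₂)/2⌋ - (n₁-1)/2`. -/
theorem isotropic_fibration (V₁ V₂ : Type*)
    [AddCommGroup V₁] [Module ℂ V₁] [FiniteDimensional ℂ V₁]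
    [AddCommGroup V₂] [Module ℂ V₂] [FiniteDimensional ℂ V₂]
    (B₁ : V₁ →ₗ[ℂ] V₁ →ₗ[ℂ] ℂ) (B₂ : V₂ →ₗ[ℂ] V₂ →ₗ[ℂ] ℂ)
    (hB₁symm : ∀ x y, B₁ x y = B₁ y x) (hB₂symm : ∀ x y, B₂ x y = B₂ y x)
    (hB₁nd : ∀ x, (∀ y, B₁ x y = 0) → x = 0)
    (hB₂nd : ∀ x, (∀ y, B₂ x y = 0) → x = 0)
    (n₁ n₂ : ℕ) (hn₁ : Module.finrank ℂ V₁ = n₁) (hodd : Odd n₁)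
    (hn₂ : Module.finrank ℂ V₂ = n₂) :
    -- (i) `φ` maps `𝐖` into `𝐖₁`
    (∀ W : Submodule ℂ (V₁ × V₂),
      (∀ x ∈ W, ∀ y ∈ W, B₁ x.1 y.1 + B₂ x.2 y.2 = 0) →
      Module.finrank ℂ ↥W = (n₁ + n₂) / 2 →
      Module.finrank ℂ ↥(W ⊓ Submodule.fst ℂ V₁ V₂) = (n₁ - 1) / 2 →
      ((∀ x ∈ (W ⊓ Submodule.fst ℂ V₁ V₂).map (LinearMap.fst ℂ V₁ V₂),
          ∀ y ∈ (W ⊓ Submodule.fst ℂ V₁ V₂).map (LinearMap.fst ℂ V₁ V₂),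
          B₁ x y = 0) ∧
        Module.finrank ℂ
          ↥((W ⊓ Submodule.fst ℂ V₁ V₂).map (LinearMap.fst ℂ V₁ V₂)) =
            (n₁ - 1) / 2)) ∧
    -- (ii) description of the fibers of `φ`
    (∀ W₁ : Submodule ℂ V₁,
      (∀ x ∈ W₁, ∀ y ∈ W₁, B₁ x y = 0) →
      Module.finrank ℂ ↥W₁ = (n₁ - 1) / 2 →
      -- every member of the fiber lies in `W₁^⊥ ⊕ V₂`
      (∀ W : Submodule ℂ (V₁ × V₂),
        (∀ x ∈ W, ∀ y ∈ W, B₁ x.1 y.1 + B₂ x.2 y.2 = 0) →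
        Module.finrank ℂ ↥W = (n₁ + n₂) / 2 →
        Module.finrank ℂ ↥(W ⊓ Submodule.fst ℂ V₁ V₂) = (n₁ - 1) / 2 →
        (W ⊓ Submodule.fst ℂ V₁ V₂).map (LinearMap.fst ℂ V₁ V₂) = W₁ →
        W ≤ (orthComp B₁ W₁).prod (⊤ : Submodule ℂ V₂)) ∧
      -- `(W₁^⊥/W₁) ⊕ V₂` has dimension `n₂ + 1`
      Module.finrank ℂ (OrthQuot B₁ W₁ × V₂) = n₂ + 1 ∧
      -- the induced quotient map is a bijection from the fiber onto the isotropic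
      -- subspaces of the correct dimension of `(W₁^⊥/W₁) ⊕ V₂`
      (∀ Bq : OrthQuot B₁ W₁ →ₗ[ℂ] OrthQuot B₁ W₁ →ₗ[ℂ] ℂ,
        (∀ x y : ↥(orthComp B₁ W₁),
          Bq ((innerCopy B₁ W₁).mkQ x) ((innerCopy B₁ W₁).mkQ y) = B₁ x y) →
        Set.BijOn (quotImage B₁ W₁)
          {W : Submodule ℂ (V₁ × V₂) |
            (∀ x ∈ W, ∀ y ∈ W, B₁ x.1 y.1 + B₂ x.2 y.2 = 0) ∧
            Module.finrank ℂ ↥W = (n₁ + n₂) / 2 ∧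
            Module.finrank ℂ ↥(W ⊓ Submodule.fst ℂ V₁ V₂) = (n₁ - 1) / 2 ∧
            (W ⊓ Submodule.fst ℂ V₁ V₂).map (LinearMap.fst ℂ V₁ V₂) = W₁}
          {U : Submodule ℂ (OrthQuot B₁ W₁ × V₂) |
            (∀ x ∈ U, ∀ y ∈ U, Bq x.1 y.1 + B₂ x.2 y.2 = 0) ∧
            Module.finrank ℂ ↥U = (n₁ + n₂) / 2 - (n₁ - 1) / 2})) := by
  refine ⟨fun W hW _ hdim => ?_, fun W₁ hW₁ hdim₁ => ⟨fun W hW _ _ hfib => ?_, ?_, ?_⟩⟩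
  · rw [Submodule.map_fst_inf_fst, ← Submodule.finrank_inf_fst]
    exact ⟨isotropic_comap_inl hW, hdim⟩
  · rw [← hfib, Submodule.map_fst_inf_fst]
    exact le_orthComp_prod_top hW
  · have horth := finrank_add_finrank_orthComp hB₁symm hB₁nd W₁
    have hquot := (innerCopy B₁ W₁).finrank_quotient_add_finrank
    rw [finrank_innerCopy hW₁] at hquot
    rw [Module.finrank_prod]
    obtain ⟨k, rfl⟩ := hodd
    lia
  · intro Bq hBq
    simp only [Submodule.finrank_inf_fst, Submodule.map_fst_inf_fst]
    have hinv : ∀ W : Submodule ℂ (V₁ × V₂),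
        (∀ x ∈ W, ∀ y ∈ W, B₁ x.1 y.1 + B₂ x.2 y.2 = 0) →
        W.comap (LinearMap.inl ℂ V₁ V₂) = W₁ → quotLift B₁ W₁ (quotImage B₁ W₁ W) = W := by
      intro W hW hfib
      refine quotLift_quotImage ?_ hfib.ge
      rw [← hfib]
      exact le_orthComp_prod_top hW
    refine Set.InvOn.bijOn (f' := quotLift B₁ W₁)
      ⟨fun W hW => hinv W hW.1 hW.2.2.2, fun U _ => quotImage_quotLift U⟩ ?_ ?_
    · rintro W ⟨hW, hdim, -, hfib⟩
      refine ⟨isotropic_quotImage hBq hW, ?_⟩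
      have h := finrank_quotLift hW₁ (quotImage B₁ W₁ W)
      rw [hinv W hW hfib] at h
      lia
    · rintro U ⟨hU, hdim⟩
      have hL := isotropic_quotLift hBq hU
      have hfib : (quotLift B₁ W₁ U).comap (LinearMap.inl ℂ V₁ V₂) = W₁ := by
        refine (Submodule.eq_of_le_of_finrank_le (le_comap_inl_quotLift hW₁ U) ?_).symm
        have h := two_mul_finrank_le_of_isotropic hB₁symm hB₁nd (isotropic_comap_inl hL)
        obtain ⟨k, rfl⟩ := hodd
        lia
      refine ⟨hL, ?_, by rw [hfib, hdim₁], hfib⟩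
      rw [finrank_quotLift hW₁ U, hdim, hdim₁]
      lia
end

section
/- Let V′_1, …, V′_k be finite-dimensional complex vector spaces, dim V′_i = 2m′_i, each equipped with a nondegenerate alternating bilinear form, and equip V′ = V′_1 ⊕ ⋯ ⊕ V′_k with the direct-sum form. Let 𝐖′ be the set of isotropic subspaces W ⊆ V′ such that dim(W ∩ (V′_1 ⊕ ⋯ ⊕ V′_j)) = m′_1 + ⋯ + m′_j for every j = 1, …, k. Then every W ∈ 𝐖′ satisfies W = (W ∩ V′_1) ⊕ ⋯ ⊕ (W ∩ V′_k) with each W ∩ V′_i a Lagrangian subspace of V′_i, and the map sending W to (W ∩ V′_1, …, W ∩ V′_k) is a bijection from 𝐖′ onto the product over i of the sets of Lagrangian subspaces of V′_i. -/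
/-- The subspace `V'_1 ⊕ ⋯ ⊕ V'_j` of `⨁ᵢ V'_i` (components with index `≥ j` vanish). -/
def firstSub {k : ℕ} (V : Fin k → Type*) [∀ i, AddCommGroup (V i)]
    [∀ i, Module ℂ (V i)] (j : ℕ) : Submodule ℂ (∀ i, V i) where
  carrier := {v | ∀ i : Fin k, j ≤ (i : ℕ) → v i = 0}
  add_mem' := by
    intro a b ha hb i hi
    simp [Pi.add_apply, ha i hi, hb i hi]
  zero_mem' := by intro i _; rfl
  smul_mem' := by
    intro c a ha i hi
    simp [Pi.smul_apply, ha i hi]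

/-- The subspace `V'_i` of `⨁ᵢ V'_i` (components with index `≠ i` vanish). -/
def component {k : ℕ} (V : Fin k → Type*) [∀ i, AddCommGroup (V i)]
    [∀ i, Module ℂ (V i)] (i₀ : Fin k) : Submodule ℂ (∀ i, V i) where
  carrier := {v | ∀ i : Fin k, i ≠ i₀ → v i = 0}
  add_mem' := by
    intro a b ha hb i hi
    simp [Pi.add_apply, ha i hi, hb i hi]
  zero_mem' := by intro i _; rfl
  smul_mem' := by
    intro c a ha i hi
    simp [Pi.smul_apply, ha i hi]

open Module Submodule in
/-- Rank-nullity for the restriction of a linear map to a subspace. -/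
theorem finrank_map_add_finrank_inf_ker {K E F : Type*} [Field K] [AddCommGroup E] [Module K E]
    [FiniteDimensional K E] [AddCommGroup F] [Module K F] (f : E →ₗ[K] F) (p : Submodule K E) :
    finrank K (p.map f) + finrank K ↥(p ⊓ LinearMap.ker f) = finrank K p := by
  have h := (f.domRestrict p).finrank_range_add_finrank_ker
  rwa [LinearMap.range_domRestrict, LinearMap.ker_domRestrict, ← finrank_map_subtype_eq,
    Submodule.map_comap_subtype] at h

open Module Submodule in
theorem finrank_pi_univ {K ι : Type*} [Field K] [Fintype ι] {E : ι → Type*}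
    [∀ i, AddCommGroup (E i)] [∀ i, Module K (E i)] [∀ i, FiniteDimensional K (E i)]
    (p : ∀ i, Submodule K (E i)) :
    finrank K (Submodule.pi Set.univ p) = ∑ i, finrank K (p i) := by
  rw [← finrank_pi_fintype K]
  let e : Submodule.pi Set.univ p ≃ₗ[K] ∀ i, p i :=
    { toFun := fun x i => ⟨x.1 i, x.2 i trivial⟩
      invFun := fun x => ⟨fun i => x i, fun i _ => (x i).2⟩
      map_add' := fun _ _ => rfl
      map_smul' := fun _ _ => rfl }
  exact e.finrank_eq

/-- A Lagrangian subspace contains every vector orthogonal to it. -/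
theorem mem_of_forall_apply_eq_zero_of_lagrangian {K E : Type*} [Field K] [AddCommGroup E]
    [Module K E] [FiniteDimensional K E] {n : ℕ} (hE : Module.finrank K E = 2 * n)
    {B : E →ₗ[K] E →ₗ[K] K} (halt : ∀ x, B x x = 0) (hnd : ∀ x, (∀ y, B x y = 0) → x = 0)
    {L : Submodule K E} (hL : ∀ x ∈ L, ∀ y ∈ L, B x y = 0) (hLn : Module.finrank K L = n)
    {x : E} (hx : ∀ y ∈ L, B x y = 0) : x ∈ L := by
  have hB : LinearMap.IsAlt B := halt
  have hB' : LinearMap.BilinForm.Nondegenerate B :=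
    hB.isRefl.nondegenerate_iff_separatingLeft.2 hnd
  have hle : L ≤ LinearMap.BilinForm.orthogonal B L := fun y hy z hz => hL z hz y hy
  have heq : L = LinearMap.BilinForm.orthogonal B L := by
    refine Submodule.eq_of_le_of_finrank_eq hle ?_
    rw [LinearMap.BilinForm.finrank_orthogonal hB', hE, hLn]
    omega
  rw [heq]
  exact fun y hy => hB.isRefl x y (hx y hy)

section

variable {k : ℕ} {V : Fin k → Type*} [∀ i, AddCommGroup (V i)] [∀ i, Module ℂ (V i)]

theorem mem_map_proj_inf_component {W : Submodule ℂ (∀ i, V i)} {i : Fin k} {v : V i} :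
    v ∈ (W ⊓ component V i).map (LinearMap.proj i) ↔ Pi.single i v ∈ W := by
  constructor
  · rintro ⟨x, ⟨hxW, hxi⟩, rfl⟩
    have hx : Pi.single i (x i) = x := by
      ext j
      rcases eq_or_ne j i with rfl | hj
      · simp
      · rw [Pi.single_eq_of_ne hj, hxi j hj]
    simpa [hx] using hxW
  · intro h
    exact ⟨Pi.single i v, ⟨h, fun j hj => Pi.single_eq_of_ne hj v⟩, by simp⟩

theorem firstSub_zero : firstSub V 0 = ⊥ :=
  (Submodule.eq_bot_iff _).2 fun _ hx => funext fun i => hx i (Nat.zero_le _)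

theorem firstSub_succ_inf_ker_proj (i : Fin k) :
    firstSub V (i + 1) ⊓ LinearMap.ker (LinearMap.proj i : (∀ j, V j) →ₗ[ℂ] V i) =
      firstSub V i := by
  ext x
  constructor
  · rintro ⟨hx, hxi⟩ j hj
    rcases eq_or_ne j i with rfl | hji
    · exact hxi
    · exact hx j (by have := Fin.val_ne_of_ne hji; omega)
  · exact fun hx => ⟨fun j hj => hx j (by omega), hx i le_rfl⟩

/-- Isotropic for the direct-sum form, and meeting each partial sum `V 0 ⊕ ⋯ ⊕ V (j - 1)` in
a subspace of dimension `m 0 + ⋯ + m (j - 1)`. -/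
def IsFlagLagrangian (m : Fin k → ℕ) (B : ∀ i, V i →ₗ[ℂ] V i →ₗ[ℂ] ℂ)
    (W : Submodule ℂ (∀ i, V i)) : Prop :=
  (∀ x ∈ W, ∀ y ∈ W, (∑ i, B i (x i) (y i)) = 0) ∧
    ∀ j, 1 ≤ j → j ≤ k → Module.finrank ℂ ↥(W ⊓ firstSub V j) =
      ∑ i ∈ Finset.univ.filter (fun i : Fin k => (i : ℕ) < j), m i

namespace IsFlagLagrangian

variable {m : Fin k → ℕ} {B : ∀ i, V i →ₗ[ℂ] V i →ₗ[ℂ] ℂ} {W : Submodule ℂ (∀ i, V i)}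

theorem isotropic_map_proj (hW : IsFlagLagrangian m B W) (i : Fin k) :
    ∀ x ∈ (W ⊓ component V i).map (LinearMap.proj i),
      ∀ y ∈ (W ⊓ component V i).map (LinearMap.proj i), B i x y = 0 := by
  intro x hx y hy
  have h := hW.1 _ (mem_map_proj_inf_component.1 hx) _ (mem_map_proj_inf_component.1 hy)
  rw [Finset.sum_eq_single_of_mem i (Finset.mem_univ i)
    fun j _ hj => by simp [Pi.single_eq_of_ne hj]] at h
  simpa using h

variable [∀ i, FiniteDimensional ℂ (V i)]

theorem finrank_map_proj_firstSub (hW : IsFlagLagrangian m B W) (i : Fin k) :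
    Module.finrank ℂ ↥((W ⊓ firstSub V (i + 1)).map (LinearMap.proj i)) = m i := by
  have h := finrank_map_add_finrank_inf_ker (LinearMap.proj i) (W ⊓ firstSub V (i + 1))
  have h0 : Module.finrank ℂ ↥(W ⊓ firstSub V i) =
      ∑ j ∈ Finset.univ.filter (fun j : Fin k => (j : ℕ) < i), m j := by
    rcases Nat.eq_zero_or_pos (i : ℕ) with hi | hi
    · simp [hi, firstSub_zero]
    · exact hW.2 i hi i.2.le
  have hf : Finset.univ.filter (fun j : Fin k => (j : ℕ) < i + 1) =
      insert i (Finset.univ.filter fun j : Fin k => (j : ℕ) < i) := by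
    ext j
    simp only [Finset.mem_filter, Finset.mem_univ, true_and, Finset.mem_insert, Fin.ext_iff]
    omega
  rw [inf_assoc, firstSub_succ_inf_ker_proj, h0, hW.2 _ (Nat.le_add_left _ _) i.2, hf,
    Finset.sum_insert (by simp)] at h
  omega

/-- If `W` splits off all components of index below `i`, then `W ∩ V i` has dimension `m i`. -/
theorem finrank_map_proj_of_single_mem (hW : IsFlagLagrangian m B W) (i : Fin k)
    (h : ∀ j < i, ∀ x ∈ W, Pi.single j (x j) ∈ W) :
    Module.finrank ℂ ↥((W ⊓ component V i).map (LinearMap.proj i)) = m i := by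
  suffices heq : (W ⊓ component V i).map (LinearMap.proj i) =
      (W ⊓ firstSub V (i + 1)).map (LinearMap.proj i) by
    rw [heq, hW.finrank_map_proj_firstSub i]
  apply le_antisymm
  · refine Submodule.map_mono (inf_le_inf_left W fun x hx j hj => hx j ?_)
    rintro rfl
    omega
  · rintro _ ⟨x, ⟨hxW, hx⟩, rfl⟩
    rw [mem_map_proj_inf_component]
    have hsum : Pi.single i (x i) = x - ∑ j ∈ Finset.univ.filter (· < i), Pi.single j (x j) := by
      rw [eq_sub_iff_add_eq, ← Finset.sum_insert (f := fun j => Pi.single j (x j)) (by simp)]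
      conv_rhs => rw [← Finset.univ_sum_single x]
      refine Finset.sum_subset (Finset.subset_univ _) fun j _ hj => ?_
      simp only [Finset.mem_insert, Finset.mem_filter, Finset.mem_univ, true_and, not_or,
        not_lt] at hj
      rw [hx j (lt_of_le_of_ne hj.2 (Ne.symm hj.1)), Pi.single_zero]
    rw [LinearMap.proj_apply, hsum]
    exact W.sub_mem hxW (W.sum_mem fun j hj => h j (by simpa using hj) x hxW)

variable (hdim : ∀ i, Module.finrank ℂ (V i) = 2 * m i) (halt : ∀ i x, B i x x = 0)
  (hnd : ∀ i x, (∀ y, B i x y = 0) → x = 0)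

include hdim halt hnd

theorem single_mem (hW : IsFlagLagrangian m B W) (i : Fin k) :
    ∀ x ∈ W, Pi.single i (x i) ∈ W := by
  induction i using WellFoundedLT.induction with
  | ind i ih =>
    intro x hx
    rw [← mem_map_proj_inf_component]
    refine mem_of_forall_apply_eq_zero_of_lagrangian (hdim i) (halt i) (hnd i)
      (hW.isotropic_map_proj i) (hW.finrank_map_proj_of_single_mem i ih) fun y hy => ?_
    have h := hW.1 x hx _ (mem_map_proj_inf_component.1 hy)
    rw [Finset.sum_eq_single_of_mem i (Finset.mem_univ i)
      fun j _ hj => by simp [Pi.single_eq_of_ne hj]] at h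
    simpa using h

theorem finrank_map_proj (hW : IsFlagLagrangian m B W) (i : Fin k) :
    Module.finrank ℂ ↥((W ⊓ component V i).map (LinearMap.proj i)) = m i :=
  hW.finrank_map_proj_of_single_mem i fun j _ => hW.single_mem hdim halt hnd j

theorem eq_pi (hW : IsFlagLagrangian m B W) :
    W = Submodule.pi Set.univ fun i => (W ⊓ component V i).map (LinearMap.proj i) := by
  ext x
  simp only [Submodule.mem_pi, Set.mem_univ, true_implies, mem_map_proj_inf_component]
  refine ⟨fun hx i => hW.single_mem hdim halt hnd i x hx, fun h => ?_⟩
  rw [← Finset.univ_sum_single x]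
  exact W.sum_mem fun i _ => h i

theorem eq_iSup (hW : IsFlagLagrangian m B W) : W = ⨆ i : Fin k, (W ⊓ component V i) := by
  refine le_antisymm (fun x hx => ?_) (iSup_le fun i => inf_le_left)
  rw [← Finset.univ_sum_single x]
  exact Submodule.sum_mem _ fun i _ => Submodule.mem_iSup_of_mem i
    ⟨hW.single_mem hdim halt hnd i x hx, fun j hj => Pi.single_eq_of_ne hj _⟩

end IsFlagLagrangian

theorem pi_univ_inf_firstSub (L : ∀ i, Submodule ℂ (V i)) (j : ℕ) :
    Submodule.pi Set.univ L ⊓ firstSub V j =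
      Submodule.pi Set.univ fun i : Fin k => if (i : ℕ) < j then L i else ⊥ := by
  ext x
  simp only [Submodule.mem_inf, Submodule.mem_pi, Set.mem_univ, true_implies]
  constructor
  · rintro ⟨hL, hx⟩ i
    split_ifs with hi
    · exact hL i
    · exact hx i (not_lt.1 hi)
  · refine fun h => ⟨fun i => ?_, fun i hi => ?_⟩
    · have hi := h i
      split_ifs at hi
      · exact hi
      · rw [(Submodule.mem_bot ℂ).1 hi]
        exact zero_mem _
    · simpa [not_lt.2 hi] using h i

theorem isFlagLagrangian_pi [∀ i, FiniteDimensional ℂ (V i)] {m : Fin k → ℕ}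
    {B : ∀ i, V i →ₗ[ℂ] V i →ₗ[ℂ] ℂ} {L : ∀ i, Submodule ℂ (V i)}
    (hL : ∀ i, (∀ x ∈ L i, ∀ y ∈ L i, B i x y = 0) ∧ Module.finrank ℂ ↥(L i) = m i) :
    IsFlagLagrangian m B (Submodule.pi Set.univ L) := by
  refine ⟨fun x hx y hy => Finset.sum_eq_zero fun i _ =>
    (hL i).1 _ (hx i trivial) _ (hy i trivial), fun j _ _ => ?_⟩
  rw [pi_univ_inf_firstSub, finrank_pi_univ, Finset.sum_filter]
  refine Finset.sum_congr rfl fun i _ => ?_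
  split_ifs with hi
  · rw [if_pos hi, (hL i).2]
  · rw [if_neg hi, finrank_bot]

theorem map_proj_pi_inf_component (L : ∀ i, Submodule ℂ (V i)) (i : Fin k) :
    (Submodule.pi Set.univ L ⊓ component V i).map (LinearMap.proj i) = L i := by
  ext v
  rw [mem_map_proj_inf_component]
  refine ⟨fun h => by simpa using h i trivial, fun h j _ => ?_⟩
  rcases eq_or_ne j i with rfl | hj
  · simpa using h
  · rw [Pi.single_eq_of_ne hj]
    exact zero_mem _

end

/-- Let `V'_i` (`i = 1, …, k`) carry nondegenerate alternating
bilinear forms, `dim V'_i = 2m'_i`, and let `𝐖'` be the set of isotropic subspaces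
`W` of the direct sum with `dim (W ∩ (V'_1 ⊕ ⋯ ⊕ V'_j)) = m'_1 + ⋯ + m'_j` for all
`j = 1, …, k`. Then every `W ∈ 𝐖'` is the direct sum of the Lagrangian subspaces
`W ∩ V'_i ⊆ V'_i`, and `W ↦ (W ∩ V'_1, …, W ∩ V'_k)` is a bijection from `𝐖'`
onto the product of the sets of Lagrangian subspaces of the `V'_i`. -/
theorem lagrangian_product (k : ℕ) (V : Fin k → Type*)
    [∀ i, AddCommGroup (V i)] [∀ i, Module ℂ (V i)] [∀ i, FiniteDimensional ℂ (V i)]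
    (m : Fin k → ℕ) (hdim : ∀ i, Module.finrank ℂ (V i) = 2 * m i)
    (B : ∀ i, V i →ₗ[ℂ] V i →ₗ[ℂ] ℂ)
    (halt : ∀ i x, B i x x = 0)
    (hnd : ∀ i x, (∀ y, B i x y = 0) → x = 0) :
    (∀ W : Submodule ℂ (∀ i, V i),
      W ∈ {W : Submodule ℂ (∀ i, V i) |
            (∀ x ∈ W, ∀ y ∈ W, (∑ i, B i (x i) (y i)) = 0) ∧
            ∀ j, 1 ≤ j → j ≤ k →
              Module.finrank ℂ ↥(W ⊓ firstSub V j) =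
                ∑ i ∈ Finset.univ.filter (fun i : Fin k => (i : ℕ) < j), m i} →
      (W = ⨆ i : Fin k, (W ⊓ component V i)) ∧
      (∀ i : Fin k,
        (∀ x ∈ (W ⊓ component V i).map (LinearMap.proj i),
          ∀ y ∈ (W ⊓ component V i).map (LinearMap.proj i), B i x y = 0) ∧
        Module.finrank ℂ ↥((W ⊓ component V i).map (LinearMap.proj i)) = m i)) ∧
    Set.BijOn
      (fun W : Submodule ℂ (∀ i, V i) =>
        fun i : Fin k => (W ⊓ component V i).map (LinearMap.proj i))
      {W : Submodule ℂ (∀ i, V i) |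
        (∀ x ∈ W, ∀ y ∈ W, (∑ i, B i (x i) (y i)) = 0) ∧
        ∀ j, 1 ≤ j → j ≤ k →
          Module.finrank ℂ ↥(W ⊓ firstSub V j) =
            ∑ i ∈ Finset.univ.filter (fun i : Fin k => (i : ℕ) < j), m i}
      {L : ∀ i, Submodule ℂ (V i) |
        ∀ i, (∀ x ∈ L i, ∀ y ∈ L i, B i x y = 0) ∧
          Module.finrank ℂ ↥(L i) = m i} := by
  have hmem (W : Submodule ℂ (∀ i, V i)) (hW : IsFlagLagrangian m B W) (i : Fin k) :=
    And.intro (hW.isotropic_map_proj i) (hW.finrank_map_proj hdim halt hnd i)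
  refine ⟨fun W hW => ⟨IsFlagLagrangian.eq_iSup hdim halt hnd hW, hmem W hW⟩, hmem, ?_, ?_⟩
  · intro W hW W' hW' h
    rw [IsFlagLagrangian.eq_pi hdim halt hnd hW, IsFlagLagrangian.eq_pi hdim halt hnd hW']
    exact congrArg (Submodule.pi Set.univ) h
  · exact fun L hL => ⟨Submodule.pi Set.univ L, isFlagLagrangian_pi hL,
      funext (map_proj_pi_inf_component L)⟩
end
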